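/- For every q ∈ [1, 2n/(n−2s)] there exists a constant C > 0, depending only on n, σ, Ω and q, such that every infinitely differentiable function u : ℝ^n → ℝ with compact support contained in Ω satisfies (∫_Ω |u(x)|^q dx)^{1/q} ≤ C [u], where [u]² = ∫_{ℝ^n} ∫_{ℝ^n} |∇u(x) − ∇u(y)|² / |x−y|^{n+2σ} dx dy. -/

import Mathlib

open MeasureTheory

lemma aux_radial {n : ℕ} (hn : 0 < n) (σ : ℝ) (hσ : σ ∈ Set.Ioo (0:ℝ) 1) :
    Integrable (fun z : EuclideanSpace ℝ (Fin n) =>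
      min (‖z‖ ^ 2) 1 / ‖z‖ ^ ((n : ℝ) + 2 * σ)) := by
  have : Nonempty (Fin n) := ⟨⟨0, hn⟩⟩
  have key := (integrable_fun_norm_addHaar (volume : Measure (EuclideanSpace ℝ (Fin n)))
    (f := fun t : ℝ => min (t ^ 2) 1 / t ^ ((n : ℝ) + 2 * σ)))
  refine key.2 ?_
  rw [finrank_euclideanSpace_fin]
  have hsplit : Set.Ioi (0:ℝ) = Set.Ioc 0 1 ∪ Set.Ioi 1 := by
    rw [Set.Ioc_union_Ioi_eq_Ioi zero_le_one]
  have hpow : ∀ y : ℝ, 0 < y → y ^ (n - 1) = y ^ ((n : ℝ) - 1) := by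
    intro y hy
    rw [← Real.rpow_natCast, Nat.cast_sub hn]; simp
  rw [hsplit]
  refine IntegrableOn.union ?_ ?_
  · have h1 : IntegrableOn (fun y : ℝ => y ^ (1 - 2 * σ)) (Set.Ioc 0 1) := by
      have := (intervalIntegral.intervalIntegrable_rpow' (a := 0) (b := 1) (r := 1 - 2 * σ)
        (by linarith [hσ.2]))
      exact (intervalIntegrable_iff_integrableOn_Ioc_of_le zero_le_one).1 this
    refine h1.congr_fun ?_ measurableSet_Ioc
    intro y hy
    have hy0 := hy.1
    have : min (y ^ 2) 1 = y ^ (2:ℝ) := by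
      rw [min_eq_left (by nlinarith [hy.1, hy.2])]; norm_cast
    simp only [smul_eq_mul]
    rw [this, hpow y hy0, ← Real.rpow_sub hy0, ← Real.rpow_add hy0]
    congr 1; ring
  · have h1 : IntegrableOn (fun y : ℝ => y ^ (-1 - 2 * σ)) (Set.Ioi 1) :=
      integrableOn_Ioi_rpow_of_lt (by linarith [hσ.1]) one_pos
    refine h1.congr_fun ?_ measurableSet_Ioi
    intro y hy
    have hy1 : 1 < y := hy
    have hy0 : 0 < y := by linarith
    have : min (y ^ 2) 1 = 1 := min_eq_right (by nlinarith)
    simp only [smul_eq_mul]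
    rw [this, hpow y hy0, one_div, ← Real.rpow_neg hy0.le, ← Real.rpow_add hy0]
    congr 1; ring

lemma aux_finite {n : ℕ} (hn : 0 < n) (σ : ℝ) (hσ : σ ∈ Set.Ioo (0:ℝ) 1)
    {F : Type*} [NormedAddCommGroup F] [NormedSpace ℝ F]
    (f : EuclideanSpace ℝ (Fin n) → F) (hf : ContDiff ℝ 1 f) (hc : HasCompactSupport f) :
    ∫⁻ x, ∫⁻ y, ENNReal.ofReal (‖f x - f y‖ ^ 2 / ‖x - y‖ ^ ((n : ℝ) + 2 * σ)) < ⊤ := by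
  obtain ⟨L, hL⟩ := hf.lipschitzWith_of_hasCompactSupport hc one_ne_zero
  obtain ⟨M, hM⟩ := hf.continuous.bounded_above_of_compact_support hc
  set C : ℝ := (L:ℝ) ^ 2 + 4 * M ^ 2 with hC
  have hC0 : 0 ≤ C := by positivity
  set g : EuclideanSpace ℝ (Fin n) → ENNReal := fun z =>
    ENNReal.ofReal (C * (min (‖z‖ ^ 2) 1 / ‖z‖ ^ ((n : ℝ) + 2 * σ))) with hg
  have hgm : Measurable g := by
    simp only [hg]; fun_prop
  have hI : ∫⁻ z, g z < ⊤ := ((aux_radial hn σ hσ).const_mul C).lintegral_lt_top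
  set K := tsupport f
  have hK : IsCompact K := hc
  have hKm : MeasurableSet K := hK.isClosed.measurableSet
  set χ : EuclideanSpace ℝ (Fin n) → ENNReal := K.indicator 1 with hχ
  have hχm : Measurable χ := measurable_one.indicator hKm
  have hχI : ∫⁻ z, χ z < ⊤ := by
    rw [hχ, lintegral_indicator_one hKm]; exact hK.measure_lt_top
  have hb : ∀ x y, ENNReal.ofReal (‖f x - f y‖ ^ 2 / ‖x - y‖ ^ ((n : ℝ) + 2 * σ)) ≤
      χ x * g (x - y) + χ y * g (x - y) := by
    intro x y
    have h1 : ENNReal.ofReal (‖f x - f y‖ ^ 2 / ‖x - y‖ ^ ((n : ℝ) + 2 * σ)) ≤ g (x - y) := by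
      apply ENNReal.ofReal_le_ofReal
      rw [← mul_div_assoc]
      gcongr
      have a1 : ‖f x - f y‖ ≤ L * ‖x - y‖ := by
        simpa [dist_eq_norm] using hL.dist_le_mul x y
      have a2 : ‖f x - f y‖ ≤ 2 * M := by
        linarith [norm_sub_le (f x) (f y), hM x, hM y]
      have a0 := norm_nonneg (f x - f y)
      rcases le_total (‖x - y‖ ^ 2) 1 with h | h
      · rw [min_eq_left h]
        nlinarith [mul_self_le_mul_self a0 a1, sq_nonneg (M * ‖x - y‖)]
      · rw [min_eq_right h]
        nlinarith [mul_self_le_mul_self a0 a2, sq_nonneg (L:ℝ)]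
    by_cases hx : x ∈ K
    · refine h1.trans ?_
      simp [hχ, hx]
    by_cases hy : y ∈ K
    · refine h1.trans ?_
      simp [hχ, hy]
    · rw [image_eq_zero_of_notMem_tsupport hx, image_eq_zero_of_notMem_tsupport hy]
      simp
  have e1 : ∫⁻ x, ∫⁻ y, χ x * g (x - y) < ⊤ := by
    have : ∀ x, ∫⁻ y, χ x * g (x - y) = χ x * ∫⁻ z, g z := by
      intro x
      rw [lintegral_const_mul _ (by fun_prop), lintegral_sub_left_eq_self]
    simp_rw [this]
    rw [lintegral_mul_const _ hχm]
    exact ENNReal.mul_lt_top hχI hI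
  have e2 : ∫⁻ x, ∫⁻ y, χ y * g (x - y) < ⊤ := by
    rw [lintegral_lintegral_swap (by fun_prop)]
    have : ∀ y, ∫⁻ x, χ y * g (x - y) = χ y * ∫⁻ z, g z := by
      intro x
      rw [lintegral_const_mul _ (by fun_prop), lintegral_sub_right_eq_self]
    simp_rw [this]
    rw [lintegral_mul_const _ hχm]
    exact ENNReal.mul_lt_top hχI hI
  calc _ ≤ ∫⁻ x, ∫⁻ y, (χ x * g (x - y) + χ y * g (x - y)) :=
        lintegral_mono fun x => lintegral_mono fun y => hb x y
    _ = (∫⁻ x, ∫⁻ y, χ x * g (x - y)) + ∫⁻ x, ∫⁻ y, χ y * g (x - y) := by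
        rw [← lintegral_add_left (by fun_prop)]
        congr 1; ext x
        rw [lintegral_add_left (by fun_prop)]
    _ < ⊤ := ENNReal.add_lt_top.2 ⟨e1, e2⟩

lemma aux_opt (ω v g A θ : ℝ) (hω : 0 < ω) (hg : 0 ≤ g) (hA : 0 < A) (hθ1 : θ < 1)
    (h : ∀ t : ℝ, 0 < t → ω * t * v ^ 2 ≤ 2 * t * t ^ θ * g + 2 * A * (ω * t) ^ θ) :
    v ^ 2 ≤ (2 / ω + 2 * ω ^ (θ - 1)) * g ^ (1 - θ) * A ^ θ := by
  have h' : ∀ t : ℝ, 0 < t → v ^ 2 ≤ 2 / ω * (t ^ θ * g) + 2 * ω ^ (θ - 1) * (t ^ (θ - 1) * A) := by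
    intro t ht
    have := h t ht
    rw [← mul_le_mul_iff_right₀ (show 0 < ω * t by positivity)]
    refine this.trans (le_of_eq ?_)
    rw [Real.mul_rpow hω.le ht.le, Real.rpow_sub_one hω.ne', Real.rpow_sub_one ht.ne']
    field_simp
  rcases hg.eq_or_lt with rfl | hg
  · have lim : Filter.Tendsto (fun t : ℝ => 2 * ω ^ (θ - 1) * (t ^ (θ - 1) * A)) Filter.atTop
        (nhds (2 * ω ^ (θ - 1) * (0 * A))) := by
      have := tendsto_rpow_neg_atTop (show 0 < 1 - θ by linarith)
      rw [neg_sub] at this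
      exact (this.mul_const A).const_mul _
    have : v ^ 2 ≤ 2 * ω ^ (θ - 1) * (0 * A) := by
      refine ge_of_tendsto lim ?_
      filter_upwards [Filter.eventually_gt_atTop 0] with t ht
      simpa using h' t ht
    rw [Real.zero_rpow (by linarith)]
    linarith
  · refine (h' (A / g) (by positivity)).trans (le_of_eq ?_)
    have e1 : (A / g) ^ θ * g = g ^ (1 - θ) * A ^ θ := by
      rw [Real.div_rpow hA.le hg.le, Real.rpow_sub hg, Real.rpow_one]; field_simp
    have e2 : (A / g) ^ (θ - 1) * A = g ^ (1 - θ) * A ^ θ := by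
      rw [Real.rpow_sub_one (by positivity), Real.div_rpow hA.le hg.le, Real.rpow_sub hg,
        Real.rpow_one]; field_simp
    rw [e1, e2]; ring

lemma aux_ball {n : ℕ} (hn : 0 < n) (σ : ℝ) (hσ : 0 < σ) (p : ℝ) (hp : 2 ≤ p)
    {F : Type*} [NormedAddCommGroup F]
    (f : EuclideanSpace ℝ (Fin n) → F) (hf : Continuous f) (x : EuclideanSpace ℝ (Fin n))
    (r : ℝ) (hr : 0 < r) :
    volume (Metric.ball x r) * ‖f x‖ₑ ^ 2 ≤
      2 * (ENNReal.ofReal (r ^ ((n : ℝ) + 2 * σ)) *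
        ∫⁻ y, ENNReal.ofReal (‖f x - f y‖ ^ 2 / ‖x - y‖ ^ ((n : ℝ) + 2 * σ))) +
      2 * (eLpNorm f (ENNReal.ofReal p) volume ^ 2 *
        volume (Metric.ball x r) ^ (1 - 2 / p)) := by
  set B := Metric.ball x r
  have hB : MeasurableSet B := measurableSet_ball
  have h1 : ∀ y, ‖f x‖ₑ ^ 2 ≤ 2 * ‖f x - f y‖ₑ ^ 2 + 2 * ‖f y‖ₑ ^ 2 := by
    intro y
    have : ‖f x‖ ^ 2 ≤ 2 * ‖f x - f y‖ ^ 2 + 2 * ‖f y‖ ^ 2 := by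
      have := norm_add_le (f x - f y) (f y)
      rw [sub_add_cancel] at this
      nlinarith [sq_nonneg (‖f x - f y‖ - ‖f y‖), norm_nonneg (f x)]
    have := ENNReal.ofReal_le_ofReal this
    rw [ENNReal.ofReal_add (by positivity) (by positivity), ENNReal.ofReal_mul (by norm_num),
      ENNReal.ofReal_mul (by norm_num)] at this
    simpa [ENNReal.ofReal_pow] using this
  have h2 : ∀ y ∈ B, ‖f x - f y‖ₑ ^ 2 ≤ ENNReal.ofReal (r ^ ((n : ℝ) + 2 * σ)) *
      ENNReal.ofReal (‖f x - f y‖ ^ 2 / ‖x - y‖ ^ ((n : ℝ) + 2 * σ)) := by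
    intro y hy
    rw [← ENNReal.ofReal_mul (by positivity), ← ofReal_norm, ← ENNReal.ofReal_pow (by positivity)]
    apply ENNReal.ofReal_le_ofReal
    by_cases hxy : x = y
    · simp [hxy]
    have hpos : 0 < ‖x - y‖ := norm_pos_iff.2 (sub_ne_zero.2 hxy)
    have hle : ‖x - y‖ ≤ r := by
      rw [← dist_eq_norm, dist_comm]; exact (Metric.mem_ball.1 hy).le
    have : ‖x - y‖ ^ ((n : ℝ) + 2 * σ) ≤ r ^ ((n : ℝ) + 2 * σ) :=
      Real.rpow_le_rpow hpos.le hle (by positivity)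
    rw [← mul_div_assoc, le_div_iff₀ (by positivity), mul_comm]
    gcongr
  have h3 : ∫⁻ y in B, ‖f y‖ₑ ^ 2 ≤ eLpNorm f (ENNReal.ofReal p) volume ^ 2 *
        volume B ^ (1 - 2 / p) := by
    have a := eLpNorm_le_eLpNorm_mul_rpow_measure_univ (μ := volume.restrict B) (f := f)
      (p := 2) (q := ENNReal.ofReal p) (by rw [← ENNReal.ofReal_ofNat]; exact ENNReal.ofReal_le_ofReal hp)
      hf.aestronglyMeasurable
    have b : eLpNorm f 2 (volume.restrict B) ^ 2 = ∫⁻ y in B, ‖f y‖ₑ ^ 2 := by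
      rw [eLpNorm_eq_lintegral_rpow_enorm_toReal (by norm_num) (by norm_num),
        ← ENNReal.rpow_natCast, ← ENNReal.rpow_mul]
      simp
    rw [← b]
    have c : eLpNorm f 2 (volume.restrict B) ≤ eLpNorm f (ENNReal.ofReal p) volume *
        volume B ^ (1 / 2 - 1 / p) := by
      refine a.trans ?_
      rw [Measure.restrict_apply_univ, ENNReal.toReal_ofReal (by linarith)]
      simp only [ENNReal.toReal_ofNat]
      gcongr
      exact Measure.restrict_le_self
    refine (pow_le_pow_left' c 2).trans (le_of_eq ?_)
    rw [mul_pow, ← ENNReal.rpow_natCast (volume B ^ _), ← ENNReal.rpow_mul]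
    congr 2; push_cast; ring
  calc volume B * ‖f x‖ₑ ^ 2 = ∫⁻ y in B, ‖f x‖ₑ ^ 2 := by
        rw [setLIntegral_const, mul_comm]
    _ ≤ ∫⁻ y in B, (2 * ‖f x - f y‖ₑ ^ 2 + 2 * ‖f y‖ₑ ^ 2) := lintegral_mono fun y => h1 y
    _ = 2 * (∫⁻ y in B, ‖f x - f y‖ₑ ^ 2) + 2 * ∫⁻ y in B, ‖f y‖ₑ ^ 2 := by
        have m1 : Measurable fun y => ‖f x - f y‖ₑ ^ 2 :=
          (continuous_const.sub hf).enorm.measurable.pow_const 2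
        have m2 : Measurable fun y => ‖f y‖ₑ ^ 2 := hf.enorm.measurable.pow_const 2
        rw [lintegral_add_left (m1.const_mul 2), lintegral_const_mul _ m1,
          lintegral_const_mul _ m2]
    _ ≤ _ := by
        gcongr
        · calc _ ≤ ∫⁻ y in B, ENNReal.ofReal (r ^ ((n : ℝ) + 2 * σ)) *
              ENNReal.ofReal (‖f x - f y‖ ^ 2 / ‖x - y‖ ^ ((n : ℝ) + 2 * σ)) :=
                setLIntegral_mono' hB h2
            _ ≤ ∫⁻ y, ENNReal.ofReal (r ^ ((n : ℝ) + 2 * σ)) *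
              ENNReal.ofReal (‖f x - f y‖ ^ 2 / ‖x - y‖ ^ ((n : ℝ) + 2 * σ)) :=
                setLIntegral_le_lintegral _ _
            _ = _ := lintegral_const_mul' _ _ ENNReal.ofReal_ne_top

lemma aux_conv (a b c d e g : ℝ) (ha : 0 ≤ a) (hb : 0 ≤ b) (hc : 0 ≤ c) (hd : 0 ≤ d)
    (he : 0 ≤ e) (hg : 0 ≤ g)
    (h : ENNReal.ofReal a * ENNReal.ofReal b ^ 2 ≤ 2 * (ENNReal.ofReal c * ENNReal.ofReal d) +
      2 * (ENNReal.ofReal e ^ 2 * ENNReal.ofReal g)) :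
    a * b ^ 2 ≤ 2 * (c * d) + 2 * (e ^ 2 * g) := by
  rw [← ENNReal.ofReal_ofNat 2,
    ← ENNReal.ofReal_pow hb, ← ENNReal.ofReal_pow he,
    ← ENNReal.ofReal_mul (by positivity), ← ENNReal.ofReal_mul (by positivity),
    ← ENNReal.ofReal_mul (by positivity), ← ENNReal.ofReal_mul (by positivity),
    ← ENNReal.ofReal_mul (by positivity), ← ENNReal.ofReal_add (by positivity) (by positivity),
    ENNReal.ofReal_le_ofReal_iff (by positivity)] at h
  exact h

lemma aux_frac {n : ℕ} (hn : 0 < n) (σ : ℝ) (hσ : σ ∈ Set.Ioo (0:ℝ) 1) (hns : 2 * σ < n)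
    (F : Type*) [NormedAddCommGroup F] [NormedSpace ℝ F] :
    ∃ K : ℝ, 0 < K ∧ ∀ f : EuclideanSpace ℝ (Fin n) → F, ContDiff ℝ 1 f → HasCompactSupport f →
      (eLpNorm f (ENNReal.ofReal (2 * n / (n - 2 * σ))) volume).toReal ^ 2 ≤ K *
        (∫⁻ x, ∫⁻ y, ENNReal.ofReal
          (‖f x - f y‖ ^ 2 / ‖x - y‖ ^ ((n : ℝ) + 2 * σ))).toReal := by
  have : Nonempty (Fin n) := ⟨⟨0, hn⟩⟩
  have hn' : (0:ℝ) < n := by exact_mod_cast hn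
  have hd : (0:ℝ) < n - 2 * σ := by linarith
  have hσ0 := hσ.1
  set p : ℝ := 2 * n / (n - 2 * σ) with hp
  have hp2 : 2 ≤ p := by rw [hp, le_div_iff₀ hd]; linarith
  set θ : ℝ := 2 * σ / n with hθ
  have hθ0 : 0 < θ := by positivity
  have hθ1 : θ < 1 := by rw [hθ, div_lt_one hn']; exact hns
  have hpθ : (1 - θ) * (p / 2) = 1 := by rw [hp, hθ]; field_simp
  have hpθ2 : 1 - 2 / p = θ := by rw [hp, hθ]; field_simp; ring
  set ω : ℝ := (volume (Metric.ball (0 : EuclideanSpace ℝ (Fin n)) 1)).toReal with hω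
  have hω0 : 0 < ω := ENNReal.toReal_pos (Metric.measure_ball_pos _ _ one_pos).ne'
    measure_ball_lt_top.ne
  set k : ℝ := 2 / ω + 2 * ω ^ (θ - 1) with hk
  have hk0 : 0 < k := by positivity
  refine ⟨k ^ (p / 2), by positivity, fun f hf hc => ?_⟩
  have hfin := aux_finite hn σ hσ f hf hc
  set G : EuclideanSpace ℝ (Fin n) → ENNReal := fun x => ∫⁻ y, ENNReal.ofReal
          (‖f x - f y‖ ^ 2 / ‖x - y‖ ^ ((n : ℝ) + 2 * σ)) with hG
  have hfc := hf.continuous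
  have hGm : Measurable G := by
    refine Measurable.lintegral_prod_right ?_
    refine ENNReal.measurable_ofReal.comp ?_
    refine Measurable.div ?_ ?_
    · have : Continuous (fun z : EuclideanSpace ℝ (Fin n) × EuclideanSpace ℝ (Fin n) =>
        ‖f z.1 - f z.2‖ ^ 2) := by fun_prop
      exact this.measurable
    · exact Measurable.pow_const (Continuous.measurable (by fun_prop)) _
  have hGfin : ∀ᵐ x, G x < ⊤ := ae_lt_top hGm hfin.ne
  have hNfin : eLpNorm f (ENNReal.ofReal p) volume < ⊤ :=
    (hfc.memLp_of_hasCompactSupport hc).2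
  set N := (eLpNorm f (ENNReal.ofReal p) volume).toReal with hN
  have hN0 : 0 ≤ N := ENNReal.toReal_nonneg
  rcases hN0.eq_or_lt with h0 | hNpos
  · rw [← h0, zero_pow two_ne_zero]; positivity
  have hptw : ∀ x, G x < ⊤ → ‖f x‖ ^ p ≤ k ^ (p / 2) * N ^ (θ * p) * (G x).toReal := by
    intro x hx
    have hsq : ‖f x‖ ^ 2 ≤ k * (G x).toReal ^ (1 - θ) * (N ^ 2) ^ θ := by
      refine aux_opt ω _ _ _ θ hω0 ENNReal.toReal_nonneg (by positivity) hθ1 ?_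
      intro t ht
      set r : ℝ := t ^ (1 / (n:ℝ)) with hr
      have hr0 : 0 < r := by positivity
      have hrn : r ^ n = t := by
        rw [hr, ← Real.rpow_natCast, ← Real.rpow_mul ht.le, one_div_mul_cancel hn'.ne',
          Real.rpow_one]
      have hrs : r ^ ((n:ℝ) + 2 * σ) = t * t ^ θ := by
        rw [Real.rpow_add hr0, Real.rpow_natCast, hrn, hr, ← Real.rpow_mul ht.le]
        congr 2; rw [hθ]; ring
      have hb := aux_ball hn σ hσ0 p hp2 f hfc x r hr0
      have hvol : volume (Metric.ball x r) = ENNReal.ofReal (ω * t) := by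
        rw [Measure.addHaar_ball volume x hr0.le, finrank_euclideanSpace_fin, hrn, mul_comm,
          ENNReal.ofReal_mul hω0.le, hω, ENNReal.ofReal_toReal measure_ball_lt_top.ne]
      rw [hvol, hpθ2, hrs, ← ofReal_norm, ← ENNReal.ofReal_toReal hNfin.ne] at hb
      change _ ≤ 2 * (_ * G x) + _ at hb
      rw [← ENNReal.ofReal_toReal hx.ne, ENNReal.ofReal_rpow_of_pos (by positivity)] at hb
      replace hb := aux_conv _ _ _ _ _ _ (by positivity) (by positivity) (by positivity)
        (by positivity) (by positivity) (by positivity) hb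
      rw [← hN] at hb
      refine hb.trans (le_of_eq ?_)
      ring
    have := Real.rpow_le_rpow (by positivity) hsq (show 0 ≤ p / 2 by positivity)
    have hg0 : 0 ≤ (G x).toReal := ENNReal.toReal_nonneg
    rw [← Real.rpow_natCast, ← Real.rpow_mul (norm_nonneg _), Real.mul_rpow (by positivity)
      (by positivity), Real.mul_rpow (by positivity) (by positivity), ← Real.rpow_mul hg0, hpθ,
      Real.rpow_one, ← Real.rpow_natCast, ← Real.rpow_mul hN0, ← Real.rpow_mul hN0] at this
    have e1 : ((2:ℕ):ℝ) * (p / 2) = p := by push_cast; ring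
    have e2 : ((2:ℕ):ℝ) * θ * (p / 2) = θ * p := by push_cast; ring
    rw [e1, e2] at this
    linarith
  have hint : ENNReal.ofReal (N ^ p) ≤
      ENNReal.ofReal (k ^ (p / 2) * N ^ (θ * p)) * ∫⁻ x, G x := by
    have e : ENNReal.ofReal (N ^ p) = ∫⁻ x, ‖f x‖ₑ ^ p := by
      rw [← ENNReal.ofReal_rpow_of_pos hNpos, hN, ENNReal.ofReal_toReal hNfin.ne,
        eLpNorm_eq_lintegral_rpow_enorm_toReal (by simp; linarith) (by simp),
        ← ENNReal.rpow_mul, ENNReal.toReal_ofReal (by linarith),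
        one_div_mul_cancel (by linarith), ENNReal.rpow_one]
    rw [e, ← lintegral_const_mul' _ _ ENNReal.ofReal_ne_top]
    refine lintegral_mono_ae ?_
    filter_upwards [hGfin] with x hx
    rw [← ofReal_norm, ENNReal.ofReal_rpow_of_nonneg (norm_nonneg _) (by linarith),
      ← ENNReal.ofReal_toReal hx.ne, ← ENNReal.ofReal_mul (by positivity)]
    exact ENNReal.ofReal_le_ofReal (hptw x hx)
  set I := ∫⁻ x, G x
  rw [← ENNReal.ofReal_toReal hfin.ne, ← ENNReal.ofReal_mul (by positivity),
    ENNReal.ofReal_le_ofReal_iff (by positivity)] at hint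
  have e : N ^ p = N ^ 2 * N ^ (θ * p) := by
    rw [← Real.rpow_natCast, ← Real.rpow_add hNpos]
    congr 1; push_cast; linarith
  rw [e] at hint
  have hpos : 0 < N ^ (θ * p) := by positivity
  nlinarith [hint]

lemma aux_double {n : ℕ} (σ : ℝ) 
    {F : Type*} [NormedAddCommGroup F]
    (f : EuclideanSpace ℝ (Fin n) → F) (hfc : Continuous f)
    (hfin : ∫⁻ x, ∫⁻ y, ENNReal.ofReal
      (‖f x - f y‖ ^ 2 / ‖x - y‖ ^ ((n : ℝ) + 2 * σ)) < ⊤) :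
    ∫ x, ∫ y, ‖f x - f y‖ ^ 2 / ‖x - y‖ ^ ((n : ℝ) + 2 * σ) =
      (∫⁻ x, ∫⁻ y, ENNReal.ofReal
        (‖f x - f y‖ ^ 2 / ‖x - y‖ ^ ((n : ℝ) + 2 * σ))).toReal := by
  have hFm : Measurable (fun z : EuclideanSpace ℝ (Fin n) × EuclideanSpace ℝ (Fin n) =>
      ‖f z.1 - f z.2‖ ^ 2 / ‖z.1 - z.2‖ ^ ((n : ℝ) + 2 * σ)) := by
    refine Measurable.div ?_ ?_
    · exact Continuous.measurable (by fun_prop)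
    · exact Measurable.pow_const (Continuous.measurable (by fun_prop)) _
  have hGm : Measurable (fun x => ∫⁻ y, ENNReal.ofReal
      (‖f x - f y‖ ^ 2 / ‖x - y‖ ^ ((n : ℝ) + 2 * σ))) :=
    Measurable.lintegral_prod_right (ENNReal.measurable_ofReal.comp hFm)
  rw [← integral_toReal hGm.aemeasurable (ae_lt_top hGm hfin.ne)]
  congr 1; ext x
  rw [integral_eq_lintegral_of_nonneg_ae]
  · exact Filter.Eventually.of_forall fun y => by positivity
  · exact (hFm.comp measurable_prodMk_left).aestronglyMeasurable


/-- Sobolev-type embedding: for `q ∈ [1, 2n/(n−2s)]` with `s = 1 + σ`,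
the `L^q(Ω)`-norm is controlled by the Gagliardo seminorm `[u]` of the gradient. -/
theorem stmt_3 {n : ℕ} (hn : 0 < n) (σ : ℝ) (hσ : σ ∈ Set.Ioo (0:ℝ) 1)
    (hns : 2 * (1 + σ) < n) (Ω : Set (EuclideanSpace ℝ (Fin n)))
    (hΩne : Ω.Nonempty) (hΩopen : IsOpen Ω) (hΩbdd : Bornology.IsBounded Ω)
    (q : ℝ) (hq : q ∈ Set.Icc 1 (2 * n / (n - 2 * (1 + σ)))) :
    ∃ C > 0, ∀ u : EuclideanSpace ℝ (Fin n) → ℝ,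
      ContDiff ℝ (⊤ : ℕ∞) u → HasCompactSupport u → tsupport u ⊆ Ω →
      (∫ x in Ω, |u x| ^ q) ^ (1 / q) ≤
        C * Real.sqrt
          (∫ x, ∫ y, ‖gradient u x - gradient u y‖ ^ 2 / ‖x - y‖ ^ ((n : ℝ) + 2 * σ)) := by

  have hn' : (0:ℝ) < n := by exact_mod_cast hn
  have hσ0 := hσ.1
  have hd : (0:ℝ) < n - 2 * σ := by linarith
  have hd2 : (0:ℝ) < n - 2 * (1 + σ) := by linarith
  have hq0 : 0 < q := by linarith [hq.1]
  obtain ⟨K, hK, hKf⟩ := aux_frac hn σ hσ (by linarith) (EuclideanSpace ℝ (Fin n))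
  set p : ℝ := 2 * n / (n - 2 * σ) with hp
  have hp2 : 2 ≤ p := by rw [hp, le_div_iff₀ hd]; linarith
  set c : ℝ := ((eLpNormLESNormFDerivOfLeConst ℝ
    (volume : Measure (EuclideanSpace ℝ (Fin n))) Ω p.toNNReal q.toNNReal : NNReal) : ℝ) with hc
  have hc0 : 0 ≤ c := NNReal.coe_nonneg _
  refine ⟨(c + 1) * Real.sqrt K, by positivity, fun u hu hcu hsu => ?_⟩
  have hu1 : ContDiff ℝ 1 u := hu.of_le (by exact_mod_cast le_top)
  have hu2 : ContDiff ℝ 2 u := by exact_mod_cast contDiff_infty.1 hu 2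
  have hgrad : gradient u = fun x => (InnerProductSpace.toDual ℝ (EuclideanSpace ℝ (Fin n))).symm
    (fderiv ℝ u x) := rfl
  have hg1 : ContDiff ℝ 1 (gradient u) := by
    rw [hgrad]
    exact (InnerProductSpace.toDual ℝ
      (EuclideanSpace ℝ (Fin n))).symm.toContinuousLinearEquiv.contDiff.comp
        (hu2.fderiv_right (by norm_num))
  have hgc : HasCompactSupport (gradient u) := by
    rw [hgrad]
    exact (hcu.fderiv ℝ).comp_left (map_zero _)
  have hgn : ∀ x, ‖gradient u x‖ = ‖fderiv ℝ u x‖ := fun x => by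
    rw [hgrad]; simp
  have hfrac := hKf _ hg1 hgc
  rw [← aux_double σ _ hg1.continuous (aux_finite hn σ hσ _ hg1 hgc)] at hfrac
  set E := ∫ x, ∫ y, ‖gradient u x - gradient u y‖ ^ 2 / ‖x - y‖ ^ ((n : ℝ) + 2 * σ)
  have hNfin : eLpNorm (gradient u) (ENNReal.ofReal p) volume < ⊤ :=
    (hg1.continuous.memLp_of_hasCompactSupport hgc).2
  have hgns := eLpNorm_le_eLpNorm_fderiv_of_le
    (volume : Measure (EuclideanSpace ℝ (Fin n))) hu1
    ((subset_tsupport u).trans hsu) (p := p.toNNReal) (q := q.toNNReal)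
    (by rw [Real.one_le_toNNReal]; linarith)
    (by
      rw [finrank_euclideanSpace_fin, ← NNReal.coe_lt_coe, Real.coe_toNNReal _ (by linarith), hp]
      push_cast
      rw [div_lt_iff₀ hd]; nlinarith)
    (by
      rw [finrank_euclideanSpace_fin, NNReal.coe_inv, Real.coe_toNNReal _ (by linarith),
        Real.coe_toNNReal _ hq0.le]
      have h2 := (inv_le_inv₀ (by positivity) hq0).2 hq.2
      refine le_trans (le_of_eq ?_) h2
      rw [hp]; field_simp; ring)
    hΩbdd
  have heq : eLpNorm (fderiv ℝ u) (p.toNNReal : ENNReal) volume =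
      eLpNorm (gradient u) (ENNReal.ofReal p) volume :=
    eLpNorm_congr_norm_ae (Filter.Eventually.of_forall fun x => (hgn x).symm)
  rw [heq] at hgns
  have hlhs : (∫ x in Ω, |u x| ^ q) ^ (1 / q) =
      (eLpNorm u (q.toNNReal : ENNReal) (volume.restrict Ω)).toReal := by
    have hmem : MemLp u (q.toNNReal : ENNReal) (volume.restrict Ω) :=
      (hu.continuous.memLp_of_hasCompactSupport hcu).restrict _
    rw [hmem.eLpNorm_eq_integral_rpow_norm (by simpa using hq0) (by simp),
      ENNReal.toReal_ofReal (by positivity), ENNReal.coe_toReal, Real.coe_toNNReal _ hq0.le, one_div]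
    simp only [Real.norm_eq_abs]
  rw [hlhs]
  have h1 : (eLpNorm u (q.toNNReal : ENNReal) (volume.restrict Ω)).toReal ≤
      c * (eLpNorm (gradient u) (ENNReal.ofReal p) volume).toReal := by
    rw [hc, ← ENNReal.coe_toReal, ← ENNReal.toReal_mul]
    refine ENNReal.toReal_mono (ENNReal.mul_lt_top ENNReal.coe_lt_top hNfin).ne ?_
    exact (eLpNorm_mono_measure u Measure.restrict_le_self).trans hgns
  have h2 : (eLpNorm (gradient u) (ENNReal.ofReal p) volume).toReal ≤
      Real.sqrt K * Real.sqrt E := by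
    rw [← Real.sqrt_mul hK.le]
    exact Real.le_sqrt_of_sq_le hfrac
  have h3 : 0 ≤ Real.sqrt K * Real.sqrt E := by positivity
  nlinarith [mul_le_mul_of_nonneg_left h2 hc0]
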